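/- arXiv:2210.15335 — 2 statements merged into one kernel-verified Lean document; each statement's English description precedes it below -/
import Mathlib

section
/- Let R ≅ R1 × R2 × ⋯ × Rn with n ≥ 5, where each Ri is a local commutative ring with unity and maximal ideal Mi. Then the five nonzero proper ideals M1 × R2 × ⋯ × Rn, M1 × (0) × R3 × ⋯ × Rn, M1 × R2 × (0) × R4 × ⋯ × Rn, M1 × R2 × R3 × (0) × R5 × ⋯ × Rn, and M1 × R2 × R3 × R4 × (0) × R6 × ⋯ × Rn are pairwise distinct and pairwise adjacent in the prime ideal sum graph PIS(R); that is, they form a clique of size 5 (a subgraph isomorphic to K5). -/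
open IsLocalRing

/-- The ideal of the product ring `∀ i, Rs i` consisting of the functions whose
`i`-th coordinate lies in `J` (and whose other coordinates are arbitrary), i.e. the
product ideal `R₁ × ⋯ × J × ⋯ × Rₙ`. -/
def coordIdeal {n : ℕ} (Rs : Fin n → Type*) [∀ i, CommRing (Rs i)]
    (i : Fin n) (J : Ideal (Rs i)) : Ideal (∀ i, Rs i) :=
  Ideal.comap (Pi.evalRingHom Rs i) J

theorem single_one_mem_coordIdeal_iff {n : ℕ} {Rs : Fin n → Type*} [∀ i, CommRing (Rs i)]
    {i : Fin n} {J : Ideal (Rs i)} (hJ : J ≠ ⊤) (k : Fin n) :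
    Pi.single k 1 ∈ coordIdeal Rs i J ↔ k ≠ i := by
  change (Pi.single k 1 : ∀ i, Rs i) i ∈ J ↔ k ≠ i
  obtain rfl | h := eq_or_ne k i
  · simpa using (Ideal.ne_top_iff_one J).mp hJ
  · simp [h]

theorem ne_bot_of_single_one_mem {n : ℕ} {Rs : Fin n → Type*} [∀ i, CommRing (Rs i)]
    {k : Fin n} [Nontrivial (Rs k)] {I : Ideal (∀ i, Rs i)} (h : Pi.single k 1 ∈ I) :
    I ≠ ⊥ := by
  rintro rfl
  simpa using congrFun (Ideal.mem_bot.mp h) k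

theorem inf_coordIdeal_sup_inf_coordIdeal {n : ℕ} {Rs : Fin n → Type*}
    [∀ i, CommRing (Rs i)] (I : Ideal (∀ i, Rs i)) {j k : Fin n} (hjk : j ≠ k)
    (J : Ideal (Rs j)) (K : Ideal (Rs k)) :
    I ⊓ coordIdeal Rs j J ⊔ I ⊓ coordIdeal Rs k K = I := by
  refine le_antisymm (sup_le inf_le_left inf_le_left) fun x hx ↦ ?_
  have h : x = (1 - Pi.single j 1) * x + Pi.single j 1 * x := by ring
  rw [h]
  refine Submodule.add_mem_sup ⟨I.mul_mem_left _ hx, ?_⟩ ⟨I.mul_mem_left _ hx, ?_⟩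
  · change ((1 - Pi.single j 1) * x : ∀ i, Rs i) j ∈ J
    simp
  · change (Pi.single j 1 * x : ∀ i, Rs i) k ∈ K
    simp [Pi.single_eq_of_ne hjk.symm]

/-- For `R ≅ R₁ × ⋯ × Rₙ` (`n ≥ 5`) with each `Rᵢ` local, the five ideals
`M₁ × R₂ × ⋯ × Rₙ`, `M₁ × (0) × R₃ × ⋯ × Rₙ`, `M₁ × R₂ × (0) × R₄ × ⋯ × Rₙ`,
`M₁ × R₂ × R₃ × (0) × R₅ × ⋯ × Rₙ` and `M₁ × R₂ × R₃ × R₄ × (0) × R₆ × ⋯ × Rₙ`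
are pairwise distinct nonzero proper ideals that are pairwise adjacent in
`PIS(R)`, i.e. they form a clique of size 5 (a copy of `K₅`). -/
theorem pis_clique5_of_five_le
    (n : ℕ) (hn : 5 ≤ n) (Rs : Fin n → Type*)
    [∀ i, CommRing (Rs i)] [∀ i, IsLocalRing (Rs i)] :
    let V₁ := coordIdeal Rs ⟨0, by omega⟩ (maximalIdeal _)
    let V₂ := V₁ ⊓ coordIdeal Rs ⟨1, by omega⟩ ⊥
    let V₃ := V₁ ⊓ coordIdeal Rs ⟨2, by omega⟩ ⊥
    let V₄ := V₁ ⊓ coordIdeal Rs ⟨3, by omega⟩ ⊥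
    let V₅ := V₁ ⊓ coordIdeal Rs ⟨4, by omega⟩ ⊥
    (V₁ ≠ ⊥ ∧ V₁ ≠ ⊤) ∧ (V₂ ≠ ⊥ ∧ V₂ ≠ ⊤) ∧ (V₃ ≠ ⊥ ∧ V₃ ≠ ⊤) ∧
    (V₄ ≠ ⊥ ∧ V₄ ≠ ⊤) ∧ (V₅ ≠ ⊥ ∧ V₅ ≠ ⊤) ∧
    (V₁ ≠ V₂ ∧ V₁ ≠ V₃ ∧ V₁ ≠ V₄ ∧ V₁ ≠ V₅ ∧ V₂ ≠ V₃ ∧ V₂ ≠ V₄ ∧ V₂ ≠ V₅ ∧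
      V₃ ≠ V₄ ∧ V₃ ≠ V₅ ∧ V₄ ≠ V₅) ∧
    ((V₁ ⊔ V₂).IsPrime ∧ (V₁ ⊔ V₃).IsPrime ∧ (V₁ ⊔ V₄).IsPrime ∧ (V₁ ⊔ V₅).IsPrime ∧
      (V₂ ⊔ V₃).IsPrime ∧ (V₂ ⊔ V₄).IsPrime ∧ (V₂ ⊔ V₅).IsPrime ∧
      (V₃ ⊔ V₄).IsPrime ∧ (V₃ ⊔ V₅).IsPrime ∧ (V₄ ⊔ V₅).IsPrime) := by
  intro V₁ V₂ V₃ V₄ V₅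
  have hM (i : Fin n) : maximalIdeal (Rs i) ≠ ⊤ := Ideal.IsPrime.ne_top inferInstance
  have hB (i : Fin n) : (⊥ : Ideal (Rs i)) ≠ ⊤ := bot_ne_top
  have hV : V₁.IsPrime := Ideal.comap_isPrime _ _
  have mem (k : Fin n) : Pi.single k 1 ∈ V₁ ↔ k ≠ ⟨0, by omega⟩ :=
    single_one_mem_coordIdeal_iff (hM _) k
  have ne_bot (j k : Fin n) (hk : k ≠ ⟨0, by omega⟩) (hkj : k ≠ j) :
      V₁ ⊓ coordIdeal Rs j ⊥ ≠ ⊥ :=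
    ne_bot_of_single_one_mem
      ⟨(mem k).mpr hk, (single_one_mem_coordIdeal_iff (hB j) k).mpr hkj⟩
  have ne_top (j : Fin n) : V₁ ⊓ coordIdeal Rs j ⊥ ≠ ⊤ :=
    ne_top_of_le_ne_top hV.ne_top inf_le_left
  have ne_left (j : Fin n) (hj : j ≠ ⟨0, by omega⟩) : V₁ ≠ V₁ ⊓ coordIdeal Rs j ⊥ := fun h ↦
    (single_one_mem_coordIdeal_iff (hB j) j).mp (h.le ((mem j).mpr hj)).2 rfl
  have ne (j k : Fin n) (hj : j ≠ ⟨0, by omega⟩) (hjk : j ≠ k) :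
      V₁ ⊓ coordIdeal Rs j ⊥ ≠ V₁ ⊓ coordIdeal Rs k ⊥ := fun h ↦
    (single_one_mem_coordIdeal_iff (hB j) j).mp
      (h.ge ⟨(mem j).mpr hj, (single_one_mem_coordIdeal_iff (hB k) j).mpr hjk⟩).2 rfl
  have prime_left (j : Fin n) : (V₁ ⊔ V₁ ⊓ coordIdeal Rs j ⊥).IsPrime := by
    rwa [sup_inf_self]
  have prime (j k : Fin n) (hjk : j ≠ k) :
      (V₁ ⊓ coordIdeal Rs j ⊥ ⊔ V₁ ⊓ coordIdeal Rs k ⊥).IsPrime := by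
    rwa [inf_coordIdeal_sup_inf_coordIdeal V₁ hjk]
  refine ⟨⟨ne_bot_of_single_one_mem ((mem ⟨1, by omega⟩).mpr (by simp)), hV.ne_top⟩,
    ⟨ne_bot _ ⟨2, by omega⟩ (by simp) (by simp), ne_top _⟩,
    ⟨ne_bot _ ⟨1, by omega⟩ (by simp) (by simp), ne_top _⟩,
    ⟨ne_bot _ ⟨1, by omega⟩ (by simp) (by simp), ne_top _⟩,
    ⟨ne_bot _ ⟨1, by omega⟩ (by simp) (by simp), ne_top _⟩,
    ⟨ne_left _ (by simp), ne_left _ (by simp), ne_left _ (by simp), ne_left _ (by simp),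
      ?_, ?_, ?_, ?_, ?_, ?_⟩,
    prime_left _, prime_left _, prime_left _, prime_left _, ?_, ?_, ?_, ?_, ?_, ?_⟩
  all_goals first
    | exact ne _ _ (by simp) (by simp)
    | exact prime _ _ (by simp)
end

section
/- Let R1 be a local commutative ring with unity whose maximal ideal is M1 = ⟨x, y⟩ for elements x, y ∈ R1 such that the four ideals ⟨x⟩, ⟨y⟩, ⟨x + y⟩, and M1 of R1 are pairwise distinct, and let F2 be a field. Then in the prime ideal sum graph PIS(R1 × F2), the five nonzero proper ideals ⟨x⟩ × F2, ⟨y⟩ × F2, ⟨x + y⟩ × F2, M1 × F2, and M1 × (0) are pairwise distinct and pairwise adjacent; that is, they form a clique of size 5 (a subgraph isomorphic to K5). -/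
open IsLocalRing

theorem Ideal.prod_sup_prod {R S : Type*} [CommRing R] [CommRing S]
    (I I' : Ideal R) (J J' : Ideal S) :
    I.prod J ⊔ I'.prod J' = (I ⊔ I').prod (J ⊔ J') := by
  refine le_antisymm (sup_le (Ideal.prod_mono le_sup_left le_sup_left)
    (Ideal.prod_mono le_sup_right le_sup_right)) ?_
  rintro ⟨r, s⟩ ⟨hr, hs⟩
  obtain ⟨a, ha, b, hb, rfl⟩ := Submodule.mem_sup.1 hr
  obtain ⟨c, hc, d, hd, rfl⟩ := Submodule.mem_sup.1 hs
  exact Submodule.mem_sup.2 ⟨(a, c), ⟨ha, hc⟩, (b, d), ⟨hb, hd⟩, rfl⟩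

theorem Ideal.span_singleton_sup_span_singleton_add {R : Type*} [CommRing R] (x y : R) :
    Ideal.span {x} ⊔ Ideal.span {x + y} = Ideal.span {x, y} := by
  rw [← Ideal.span_union, Set.singleton_union, add_comm, Ideal.span_pair_add_left]

/-- Let `R₁` be a local ring whose maximal ideal is `M₁ = ⟨x, y⟩`, where the ideals
`⟨x⟩`, `⟨y⟩`, `⟨x + y⟩` and `M₁` are pairwise distinct, and let `F₂` be a field.
Then in `PIS(R₁ × F₂)` the five ideals `⟨x⟩ × F₂`, `⟨y⟩ × F₂`, `⟨x + y⟩ × F₂`,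
`M₁ × F₂` and `M₁ × (0)` are pairwise distinct nonzero proper ideals that are
pairwise adjacent, i.e. they form a clique of size 5 (a copy of `K₅`). -/
theorem pis_clique5_of_two_generated_maximal_ideal
    (R₁ : Type*) [CommRing R₁] [IsLocalRing R₁] (x y : R₁)
    (hM₁ : maximalIdeal R₁ = Ideal.span {x, y})
    (hxy : ([Ideal.span {x}, Ideal.span {y}, Ideal.span {x + y},
      maximalIdeal R₁] : List (Ideal R₁)).Pairwise (· ≠ ·))
    (F₂ : Type*) [Field F₂] :
    let J₁ : Ideal (R₁ × F₂) := (Ideal.span {x}).prod ⊤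
    let J₂ : Ideal (R₁ × F₂) := (Ideal.span {y}).prod ⊤
    let J₃ : Ideal (R₁ × F₂) := (Ideal.span {x + y}).prod ⊤
    let J₄ : Ideal (R₁ × F₂) := (maximalIdeal R₁).prod ⊤
    let J₅ : Ideal (R₁ × F₂) := (maximalIdeal R₁).prod ⊥
    (J₁ ≠ ⊥ ∧ J₁ ≠ ⊤) ∧ (J₂ ≠ ⊥ ∧ J₂ ≠ ⊤) ∧ (J₃ ≠ ⊥ ∧ J₃ ≠ ⊤) ∧
    (J₄ ≠ ⊥ ∧ J₄ ≠ ⊤) ∧ (J₅ ≠ ⊥ ∧ J₅ ≠ ⊤) ∧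
    ([J₁, J₂, J₃, J₄, J₅] : List (Ideal (R₁ × F₂))).Pairwise (· ≠ ·) ∧
    ((J₁ ⊔ J₂).IsPrime ∧ (J₁ ⊔ J₃).IsPrime ∧ (J₁ ⊔ J₄).IsPrime ∧ (J₁ ⊔ J₅).IsPrime ∧
      (J₂ ⊔ J₃).IsPrime ∧ (J₂ ⊔ J₄).IsPrime ∧ (J₂ ⊔ J₅).IsPrime ∧
      (J₃ ⊔ J₄).IsPrime ∧ (J₃ ⊔ J₅).IsPrime ∧ (J₄ ⊔ J₅).IsPrime) := by
  intro J₁ J₂ J₃ J₄ J₅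
  simp only [List.pairwise_cons, List.mem_cons, List.not_mem_nil, or_false, forall_eq_or_imp,
    forall_eq] at hxy
  obtain ⟨⟨hxy, hxa, hxM⟩, ⟨hya, hyM⟩, haM, -⟩ := hxy
  have hle : ∀ {a : R₁}, a ∈ maximalIdeal R₁ → Ideal.span {a} ≤ maximalIdeal R₁ :=
    fun h => (Ideal.span_singleton_le_iff_mem _).2 h
  have hxm : x ∈ maximalIdeal R₁ := hM₁ ▸ Ideal.subset_span (by simp)
  have hym : y ∈ maximalIdeal R₁ := hM₁ ▸ Ideal.subset_span (by simp)
  have hx := hle hxm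
  have hy := hle hym
  have ha := hle (add_mem hxm hym)
  have hM : maximalIdeal R₁ ≠ ⊥ := fun h =>
    hxy ((le_bot_iff.1 (h ▸ hx)).trans (le_bot_iff.1 (h ▸ hy)).symm)
  have hMtop : maximalIdeal R₁ ≠ ⊤ := Ideal.IsPrime.ne_top'
  have hproper : ∀ {I : Ideal R₁}, I ≤ maximalIdeal R₁ →
      I.prod (⊤ : Ideal F₂) ≠ ⊥ ∧ I.prod (⊤ : Ideal F₂) ≠ ⊤ := fun hI =>
    ⟨fun h => top_ne_bot (Ideal.prod_eq_bot_iff.1 h).2,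
      fun h => hMtop (top_le_iff.1 ((Ideal.prod_eq_top_iff.1 h).1 ▸ hI))⟩
  have hprime : ∀ {I I' : Ideal R₁} {J : Ideal F₂}, I ⊔ I' = maximalIdeal R₁ →
      (I.prod (⊤ : Ideal F₂) ⊔ I'.prod J).IsPrime := fun {I I' J} h => by
    rw [Ideal.prod_sup_prod, h, top_sup_eq]
    exact Ideal.isPrime_ideal_prod_top
  have hsup_xy : Ideal.span {x} ⊔ Ideal.span {y} = maximalIdeal R₁ := by
    rw [hM₁, Ideal.span_insert]
  have hsup_xa : Ideal.span {x} ⊔ Ideal.span {x + y} = maximalIdeal R₁ := by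
    rw [hM₁, Ideal.span_singleton_sup_span_singleton_add]
  have hsup_ya : Ideal.span {y} ⊔ Ideal.span {x + y} = maximalIdeal R₁ := by
    rw [hM₁, add_comm, Ideal.span_singleton_sup_span_singleton_add, Set.pair_comm]
  refine ⟨hproper hx, hproper hy, hproper ha, hproper le_rfl,
    ⟨fun h => hM (Ideal.prod_eq_bot_iff.1 h).1, fun h => hMtop (Ideal.prod_eq_top_iff.1 h).1⟩,
    ?_, hprime hsup_xy, hprime hsup_xa, hprime (sup_eq_right.2 hx), hprime (sup_eq_right.2 hx),
    hprime hsup_ya, hprime (sup_eq_right.2 hy), hprime (sup_eq_right.2 hy),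
    hprime (sup_eq_right.2 ha), hprime (sup_eq_right.2 ha), hprime (sup_idem _)⟩
  simp [J₁, J₂, J₃, J₄, J₅, Ideal.prod_inj, hxy, hxa, hxM, hya, hyM, haM]
end
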